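/- For any pseudo-flow f on a network G: every vertex u with positive excess has a path in the residual graph G_f from u to either a vertex with positive deficit or to the source s; symmetrically, every vertex v with positive deficit has a path in G_f to v starting from either a vertex with positive excess or from the sink t. -/

import Mathlib

open Finset

/-- A flow network on vertex set `V`: integral capacities, a source `s` and a sink `t`. -/
structure Network (V : Type) where
  c : V → V → ℤ
  s : V
  t : V
  st_ne : s ≠ t
  cap_nonneg : ∀ u v, 0 ≤ c u v

variable {V : Type} [Fintype V] [DecidableEq V]

/-- A pseudo-flow: capacity constraints only. -/
def IsPseudoflow (N : Network V) (f : V → V → ℤ) : Prop :=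
  ∀ u v, 0 ≤ f u v ∧ f u v ≤ N.c u v

def inflow (f : V → V → ℤ) (u : V) : ℤ := ∑ v, f v u
def outflow (f : V → V → ℤ) (u : V) : ℤ := ∑ v, f u v
def netFlow (f : V → V → ℤ) (u : V) : ℤ := inflow f u - outflow f u
def exc (f : V → V → ℤ) (u : V) : ℤ := max (netFlow f u) 0
def deficit (f : V → V → ℤ) (u : V) : ℤ := max (- netFlow f u) 0

/-- A pre-flow: pseudo-flow with nonnegative excess at every non-terminal vertex. -/
def IsPreflow (N : Network V) (f : V → V → ℤ) : Prop :=
  IsPseudoflow N f ∧ ∀ u, u ≠ N.s → u ≠ N.t → 0 ≤ netFlow f u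

/-- A feasible flow: pseudo-flow satisfying conservation at non-terminals. -/
def IsFlow (N : Network V) (f : V → V → ℤ) : Prop :=
  IsPseudoflow N f ∧ ∀ u, u ≠ N.s → u ≠ N.t → netFlow f u = 0

/-- Value of a flow: net flow out of the source. -/
def flowValue (N : Network V) (f : V → V → ℤ) : ℤ := outflow f N.s - inflow f N.s

/-- Residual edge `(u,v)`: either the forward edge `(u,v)` is unsaturated, or the
backward edge of `(v,u)` carries positive flow. -/
def ResEdge (N : Network V) (f : V → V → ℤ) (u v : V) : Prop :=
  f u v < N.c u v ∨ 0 < f v u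

/-- Reachability in the residual graph. -/
def ResReach (N : Network V) (f : V → V → ℤ) : V → V → Prop :=
  Relation.ReflTransGen (ResEdge N f)

/-- Edge of the underlying network. -/
def GEdge (N : Network V) (u v : V) : Prop := 0 < N.c u v

/-- `f` saturates the cut `δ(S,T)`: every edge from `S` to `T` is at capacity and
every edge from `T` to `S` carries zero flow. -/
def SaturatesCut (N : Network V) (f : V → V → ℤ) (S T : Finset V) : Prop :=
  ∀ u ∈ S, ∀ v ∈ T, f u v = N.c u v ∧ f v u = 0

/-- `(S,T)` is an s–t cut partition of the vertices. -/
def IsCutPartition (N : Network V) (S T : Finset V) : Prop :=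
  S ∪ T = Finset.univ ∧ Disjoint S T ∧ N.s ∈ S ∧ N.t ∈ T

/-- Capacity of the cut `δ(S,T)`. -/
def cutCap (N : Network V) (S T : Finset V) : ℤ := ∑ u ∈ S, ∑ v ∈ T, N.c u v

/-- Valid heights for Push-Relabel: `h s = n`, `h t = 0`, and `h u ≤ h v + 1`
for every residual edge `(u,v)`. -/
def ValidHeights (N : Network V) (f : V → V → ℤ) (h : V → ℕ) : Prop :=
  h N.s = Fintype.card V ∧ h N.t = 0 ∧ ∀ u v, ResEdge N f u v → h u ≤ h v + 1

theorem sum_netFlow_aux (f : V → V → ℤ) (S : Finset V) :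
    ∑ w ∈ S, netFlow f w = ∑ w ∈ S, ∑ v ∈ Sᶜ, (f v w - f w v) := by
  have h : ∀ w, netFlow f w = ∑ v ∈ S, (f v w - f w v) + ∑ v ∈ Sᶜ, (f v w - f w v) := by
    intro w
    rw [Finset.sum_add_sum_compl, Finset.sum_sub_distrib]
    rfl
  simp only [h, Finset.sum_add_distrib]
  have h0 : ∑ w ∈ S, ∑ v ∈ S, (f v w - f w v) = 0 := by
    simp only [Finset.sum_sub_distrib]
    rw [Finset.sum_comm, sub_self]
  rw [h0, zero_add]

/-- in a pseudo-flow, every excess vertex has a residual path to a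
deficit vertex or to `s`; every deficit vertex has a residual path to it from an
excess vertex or from `t`. -/
theorem stmt7 (N : Network V) (f : V → V → ℤ) (hpf : IsPseudoflow N f)
    (hconn : ∀ u : V, Relation.ReflTransGen (GEdge N) N.s u ∧
      Relation.ReflTransGen (GEdge N) u N.t) :
    (∀ u : V, u ≠ N.s → u ≠ N.t → 0 < exc f u →
      ∃ v, (0 < deficit f v ∨ v = N.s) ∧ ResReach N f u v) ∧
    (∀ v : V, v ≠ N.s → v ≠ N.t → 0 < deficit f v →
      ∃ u, (0 < exc f u ∨ u = N.t) ∧ ResReach N f u v) := by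
  classical
  refine ⟨fun u _ _ hu => ?_, fun v _ _ hv => ?_⟩
  · by_contra hcon
    push Not at hcon
    let S : Finset V := Finset.univ.filter (fun v => ResReach N f u v)
    have h1 : ∑ w ∈ S, netFlow f w ≤ 0 := by
      rw [sum_netFlow_aux]
      refine Finset.sum_nonpos fun w hw => Finset.sum_nonpos fun x hx => ?_
      have hw' : ResReach N f u w := by simpa [S] using hw
      have hx' : ¬ ResReach N f u x := by simpa [S] using hx
      have hr : ¬ ResEdge N f w x := fun e => hx' (Relation.ReflTransGen.tail hw' e)
      unfold ResEdge at hr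
      push Not at hr
      have := (hpf w x).1
      linarith [hr.2]
    have h2 : 0 < ∑ w ∈ S, netFlow f w := by
      refine Finset.sum_pos' (fun w hw => ?_) ⟨u, ?_, ?_⟩
      · have hw' : ResReach N f u w := by simpa [S] using hw
        by_contra hn
        exact hcon w (Or.inl (lt_max_of_lt_left (by linarith))) hw'
      · exact Finset.mem_filter.mpr ⟨Finset.mem_univ _, Relation.ReflTransGen.refl⟩
      · simpa [exc] using hu
    linarith
  · by_contra hcon
    push Not at hcon
    let S : Finset V := Finset.univ.filter (fun u => ResReach N f u v)
    have h1 : 0 ≤ ∑ w ∈ S, netFlow f w := by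
      rw [sum_netFlow_aux]
      refine Finset.sum_nonneg fun w hw => Finset.sum_nonneg fun x hx => ?_
      have hw' : ResReach N f w v := by simpa [S] using hw
      have hx' : ¬ ResReach N f x v := by simpa [S] using hx
      have hr : ¬ ResEdge N f x w := fun e => hx' (Relation.ReflTransGen.head e hw')
      unfold ResEdge at hr
      push Not at hr
      have := (hpf x w).1
      linarith [hr.2]
    have h2 : 0 < ∑ w ∈ S, - netFlow f w := by
      refine Finset.sum_pos' (fun w hw => ?_) ⟨v, ?_, ?_⟩
      · have hw' : ResReach N f w v := by simpa [S] using hw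
        by_contra hn
        exact hcon w (Or.inl (lt_max_of_lt_left (by linarith))) hw'
      · exact Finset.mem_filter.mpr ⟨Finset.mem_univ _, Relation.ReflTransGen.refl⟩
      · simpa [deficit] using hv
    rw [Finset.sum_neg_distrib] at h2
    linarith
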